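/- Every almost periodic pattern Γ ⊂ ℤ^n possesses a uniform density: there exists a number D(Γ) ∈ [0,1] such that for every ε > 0 there is R_0 > 0 with |Card(B(x,R) ∩ Γ)/Card(B(x,R) ∩ ℤ^n) − D(Γ)| ≤ ε for all R ≥ R_0 and all x ∈ ℝ^n. -/

import Mathlib

open Filter MeasureTheory
open scoped BigOperators

noncomputable section

/-- The projection `p : ℝ → ℤ`: the unique `k` with `k - 1/2 < x ≤ k + 1/2`. -/
def roundHalf (x : ℝ) : ℤ := ⌈x - 1/2⌉

/-- Coercion of an integer vector to a real vector. -/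
def intVec {n : ℕ} (v : Fin n → ℤ) : Fin n → ℝ := fun i => (v i : ℝ)

/-- The set of integer points of `ℝ^n`. -/
def intPoints (n : ℕ) : Set (Fin n → ℝ) := Set.range (intVec (n := n))

/-- The coordinatewise projection `π : ℝ^n → ℤ^n`. -/
def discretize {n : ℕ} (x : Fin n → ℝ) : Fin n → ℤ := fun i => roundHalf (x i)

/-- `π` viewed as a self-map of `ℝ^n`. -/
def discretizeR {n : ℕ} (x : Fin n → ℝ) : Fin n → ℝ := intVec (discretize x)

/-- The image of a set `Γ` under the discretization `P̂` of the matrix `P`. -/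
def PhatImg {n : ℕ} (P : Matrix (Fin n) (Fin n) ℝ) (Γ : Set (Fin n → ℝ)) :
    Set (Fin n → ℝ) :=
  (fun x => discretizeR (P.mulVec x)) '' Γ

/-- The uniform `R`-density `D_R^+`. Balls are sup-norm balls. -/
def DRplus {n : ℕ} (Γ : Set (Fin n → ℝ)) (R : ℝ) : ℝ :=
  ⨆ x : Fin n → ℝ,
    ((Metric.ball x R ∩ Γ).ncard : ℝ) / ((Metric.ball x R ∩ intPoints n).ncard : ℝ)

/-- Relatively dense with parameter `R₀`. -/
def RelativelyDenseWith {n : ℕ} (Γ : Set (Fin n → ℝ)) (R₀ : ℝ) : Prop :=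
  ∀ x : Fin n → ℝ, ∀ r, R₀ ≤ r → (Metric.ball x r ∩ Γ).Nonempty

def RelativelyDense {n : ℕ} (Γ : Set (Fin n → ℝ)) : Prop :=
  ∃ R₀ > 0, RelativelyDenseWith Γ R₀

/-- Uniformly discrete with parameter `r₀`. -/
def UniformlyDiscreteWith {n : ℕ} (Γ : Set (Fin n → ℝ)) (r₀ : ℝ) : Prop :=
  ∀ x : Fin n → ℝ, ∀ r, 0 < r → r ≤ r₀ → (Metric.ball x r ∩ Γ).Subsingleton

def UniformlyDiscrete {n : ℕ} (Γ : Set (Fin n → ℝ)) : Prop :=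
  ∃ r₀ > 0, UniformlyDiscreteWith Γ r₀

def Delone {n : ℕ} (Γ : Set (Fin n → ℝ)) : Prop :=
  RelativelyDense Γ ∧ UniformlyDiscrete Γ

/-- The translateSet `Γ + v`. -/
def translateSet {n : ℕ} (Γ : Set (Fin n → ℝ)) (v : Fin n → ℝ) : Set (Fin n → ℝ) :=
  (· + v) '' Γ

/-- `N` is a set of `ε`-translations of `Γ` with radius `Rε`. -/
def IsEpsTranslationSet {n : ℕ} (Γ : Set (Fin n → ℝ)) (ε Rε : ℝ)
    (N : Set (Fin n → ℝ)) : Prop :=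
  N ⊆ intPoints n ∧ RelativelyDense N ∧
    ∀ R, Rε ≤ R → ∀ v ∈ N, DRplus (symmDiff (translateSet Γ v) Γ) R < ε

/-- Almost periodic pattern. -/
def AlmostPeriodicPattern {n : ℕ} (Γ : Set (Fin n → ℝ)) : Prop :=
  Γ ⊆ intPoints n ∧ Delone Γ ∧
    ∀ ε > 0, ∃ Rε > 0, ∃ N : Set (Fin n → ℝ), IsEpsTranslationSet Γ ε Rε N

/-- `Γ` has uniform density `D`. -/
def HasUnifDensity {n : ℕ} (Γ : Set (Fin n → ℝ)) (D : ℝ) : Prop :=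
  ∀ ε > 0, ∃ R₀ > 0, ∀ R, R₀ ≤ R → ∀ x : Fin n → ℝ,
    |((Metric.ball x R ∩ Γ).ncard : ℝ) / ((Metric.ball x R ∩ intPoints n).ncard : ℝ) - D| ≤ ε

/-- `Γ ∩ (Γ - v)`, the set of `x ∈ Γ` with `x + v ∈ Γ`. -/
def diffSet {n : ℕ} (Γ : Set (Fin n → ℝ)) (v : Fin n → ℝ) : Set (Fin n → ℝ) :=
  Γ ∩ {x | x + v ∈ Γ}

/-- `E` is equidistributed modulo `ℤ^n`: averages of continuous `ℤ^n`-periodic functions over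
`E ∩ B_R` converge to the Haar integral. -/
def EquidistributedModZn {n : ℕ} (E : Set (Fin n → ℝ)) : Prop :=
  ∀ f : (Fin n → ℝ) → ℝ, Continuous f →
    (∀ (x : Fin n → ℝ) (v : Fin n → ℤ), f (x + intVec v) = f x) →
    Filter.Tendsto (fun R : ℝ =>
        (∑ᶠ x ∈ E ∩ Metric.ball (0 : Fin n → ℝ) R, f x) /
          ((E ∩ Metric.ball (0 : Fin n → ℝ) R).ncard : ℝ))
      Filter.atTop
      (nhds (∫ x in Set.pi Set.univ (fun _ : Fin n => Set.Ico (0:ℝ) 1), f x))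

/-- `P` is totally irrational: `P(ℤ^n)` is equidistributed modulo `ℤ^n`. -/
def TotallyIrrational {n : ℕ} (P : Matrix (Fin n) (Fin n) ℝ) : Prop :=
  EquidistributedModZn (P.mulVec '' intPoints n)

/-- Rate of injectivity in time 1. -/
def tauOne {n : ℕ} (P : Matrix (Fin n) (Fin n) ℝ) : ℝ :=
  Filter.limsup (fun R : ℝ =>
    ((PhatImg P (intPoints n) ∩ Metric.ball (0 : Fin n → ℝ) R).ncard : ℝ) /
      ((intPoints n ∩ Metric.ball (0 : Fin n → ℝ) R).ncard : ℝ)) Filter.atTop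

/-- The successive images `(P̂_k ∘ ⋯ ∘ P̂_1)(Γ)`. -/
def seqImg {n : ℕ} (P : ℕ → Matrix (Fin n) (Fin n) ℝ) :
    ℕ → Set (Fin n → ℝ) → Set (Fin n → ℝ)
  | 0, Γ => Γ
  | k + 1, Γ => PhatImg (P (k + 1)) (seqImg P k Γ)

/-- Rate of injectivity in time `k` of the sequence `(P_k)`. -/
def tauK {n : ℕ} (P : ℕ → Matrix (Fin n) (Fin n) ℝ) (k : ℕ) : ℝ :=
  Filter.limsup (fun R : ℝ =>
    ((seqImg P k (intPoints n) ∩ Metric.ball (0 : Fin n → ℝ) R).ncard : ℝ) /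
      ((intPoints n ∩ Metric.ball (0 : Fin n → ℝ) R).ncard : ℝ)) Filter.atTop

/-- A fixed norm on `M_n(ℝ)`: the sup of absolute values of the entries. -/
def matNorm {n : ℕ} (A : Matrix (Fin n) (Fin n) ℝ) : ℝ :=
  ⨆ p : Fin n × Fin n, |A p.1 p.2|


/-- The function `φ_u`, a "weighted projection" of `u` on `ℤ^n`. -/
def phiFn {n : ℕ} (u : Fin n → ℝ) (v : Fin n → ℤ) : ℝ :=
  if ‖u - intVec v‖ < 1 then ∏ i, (1 - |u i - (v i : ℝ)|) else 0

/-- `I_ℚ(A)`: the set of indices `i` such that all entries of the `i`-th row of `A`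
are rational. -/
def IQ {n : ℕ} (A : Matrix (Fin n) (Fin n) ℝ) : Set (Fin n) :=
  {i | ∀ j, ∃ q : ℚ, A i j = (q : ℝ)}

/-- A sequence of matrices all lying in `O_n(ℝ)`. -/
def IsOnSeq {n : ℕ} (P : ℕ → Matrix (Fin n) (Fin n) ℝ) : Prop :=
  ∀ k, P k ∈ Matrix.orthogonalGroup (Fin n) ℝ

/-- The `ℓ^∞` distance on sequences of matrices. -/
def seqDist {n : ℕ} (P Q : ℕ → Matrix (Fin n) (Fin n) ℝ) : ℝ :=
  ⨆ k : ℕ, matNorm (P k - Q k)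

/-- Open subsets of `ℓ^∞(O_n(ℝ))`. -/
def IsOpenSeq {n : ℕ} (U : Set {P : ℕ → Matrix (Fin n) (Fin n) ℝ // IsOnSeq P}) : Prop :=
  ∀ P ∈ U, ∃ δ > 0, ∀ Q : {P : ℕ → Matrix (Fin n) (Fin n) ℝ // IsOnSeq P},
    seqDist P.1 Q.1 < δ → Q ∈ U

/-- Dense subsets of `ℓ^∞(O_n(ℝ))`. -/
def IsDenseSeq {n : ℕ} (U : Set {P : ℕ → Matrix (Fin n) (Fin n) ℝ // IsOnSeq P}) : Prop :=
  ∀ P : {P : ℕ → Matrix (Fin n) (Fin n) ℝ // IsOnSeq P}, ∀ δ > 0,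
    ∃ Q ∈ U, seqDist P.1 Q.1 < δ

/-- The number of points of `E` in the open ball `B(x, R)`, as a real number. -/
def ballCount {n : ℕ} (E : Set (Fin n → ℝ)) (x : Fin n → ℝ) (R : ℝ) : ℝ :=
  ((Metric.ball x R ∩ E).ncard : ℝ)

lemma intVec_injective {n : ℕ} : Function.Injective (intVec (n := n)) := by
  intro a b h
  funext i
  exact Int.cast_injective (α := ℝ) (congrFun h i)

lemma ball_inter_intPoints {n : ℕ} (x : Fin n → ℝ) {R : ℝ} (hR : 0 < R) :
    Metric.ball x R ∩ intPoints n =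
      intVec '' (Fintype.piFinset fun i => Finset.Ioo ⌊x i - R⌋ ⌈x i + R⌉ :
        Finset (Fin n → ℤ)) := by
  have key : ∀ k : Fin n → ℤ, intVec k ∈ Metric.ball x R ↔
      k ∈ Fintype.piFinset fun i => Finset.Ioo ⌊x i - R⌋ ⌈x i + R⌉ := by
    intro k
    rw [Metric.mem_ball, dist_pi_lt_iff hR, Fintype.mem_piFinset]
    refine forall_congr' fun i => ?_
    rw [Finset.mem_Ioo, Int.floor_lt, Int.lt_ceil, Real.dist_eq, abs_lt]
    simp only [intVec]
    constructor <;> rintro ⟨h1, h2⟩ <;> constructor <;> linarith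
  ext y
  constructor
  · rintro ⟨h1, k, rfl⟩
    exact ⟨k, (key k).1 h1, rfl⟩
  · rintro ⟨k, hk, rfl⟩
    exact ⟨(key k).2 hk, k, rfl⟩

lemma finite_ball_inter_intPoints {n : ℕ} (x : Fin n → ℝ) (R : ℝ) :
    (Metric.ball x R ∩ intPoints n).Finite := by
  rcases le_or_gt R 0 with hR | hR
  · simp [Metric.ball_eq_empty.2 hR]
  · rw [ball_inter_intPoints x hR]
    exact (Finset.finite_toSet _).image _

lemma finite_ball_inter {n : ℕ} {E : Set (Fin n → ℝ)} (hE : E ⊆ intPoints n)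
    (x : Fin n → ℝ) (R : ℝ) : (Metric.ball x R ∩ E).Finite :=
  (finite_ball_inter_intPoints x R).subset (Set.inter_subset_inter_right _ hE)

lemma ballCount_intPoints_eq_prod {n : ℕ} (x : Fin n → ℝ) {R : ℝ} (hR : 1 ≤ R) :
    ballCount (intPoints n) x R = ∏ i, ((⌈x i + R⌉ : ℝ) - ⌊x i - R⌋ - 1) := by
  rw [ballCount, ball_inter_intPoints x (by linarith),
    Set.ncard_image_of_injective _ intVec_injective, Set.ncard_coe_finset,
    Fintype.card_piFinset]
  push_cast
  refine Finset.prod_congr rfl fun i _ => ?_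
  have h1 : (⌊x i - R⌋ : ℝ) ≤ x i - R := Int.floor_le _
  have h2 : x i + R ≤ (⌈x i + R⌉ : ℝ) := Int.le_ceil _
  have h3 : (0 : ℤ) ≤ ⌈x i + R⌉ - ⌊x i - R⌋ - 1 := by
    have : (0 : ℝ) ≤ ((⌈x i + R⌉ - ⌊x i - R⌋ - 1 : ℤ) : ℝ) := by push_cast; linarith
    exact_mod_cast this
  have h4 : (((⌈x i + R⌉ - ⌊x i - R⌋ - 1).toNat : ℤ) : ℝ) =
      ((⌈x i + R⌉ - ⌊x i - R⌋ - 1 : ℤ) : ℝ) := by rw [Int.toNat_of_nonneg h3]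
  rw [Int.card_Ioo]
  push_cast at h4
  exact h4

lemma pow_le_ballCount_intPoints {n : ℕ} (x : Fin n → ℝ) {R : ℝ} (hR : 1 ≤ R) :
    (2 * R - 1) ^ n ≤ ballCount (intPoints n) x R := by
  rw [ballCount_intPoints_eq_prod x hR]
  calc (2 * R - 1) ^ n = ∏ _i : Fin n, (2 * R - 1) := by simp
    _ ≤ _ := Finset.prod_le_prod (fun i _ => by linarith) fun i _ => by
      linarith [Int.floor_le (x i - R), Int.le_ceil (x i + R)]

lemma ballCount_intPoints_le_pow {n : ℕ} (x : Fin n → ℝ) {R : ℝ} (hR : 1 ≤ R) :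
    ballCount (intPoints n) x R ≤ (2 * R + 1) ^ n := by
  rw [ballCount_intPoints_eq_prod x hR]
  calc _ ≤ ∏ _i : Fin n, (2 * R + 1) :=
        Finset.prod_le_prod
          (fun i _ => by linarith [Int.floor_le (x i - R), Int.le_ceil (x i + R)])
          fun i _ => by linarith [Int.lt_floor_add_one (x i - R), Int.ceil_lt_add_one (x i + R)]
    _ = _ := by simp

lemma ballCount_intPoints_pos {n : ℕ} (x : Fin n → ℝ) {R : ℝ} (hR : 1 ≤ R) :
    0 < ballCount (intPoints n) x R :=
  (pow_pos (by linarith) n).trans_le (pow_le_ballCount_intPoints x hR)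

lemma ballCount_nonneg {n : ℕ} (E : Set (Fin n → ℝ)) (x : Fin n → ℝ) (R : ℝ) :
    0 ≤ ballCount E x R := Nat.cast_nonneg _

lemma ballCount_mono {n : ℕ} {E F : Set (Fin n → ℝ)} (hEF : E ⊆ F) (hF : F ⊆ intPoints n)
    {x y : Fin n → ℝ} {R S : ℝ} (h : Metric.ball x R ⊆ Metric.ball y S) :
    ballCount E x R ≤ ballCount F y S := by
  unfold ballCount
  exact_mod_cast Set.ncard_le_ncard (Set.inter_subset_inter h hEF) (finite_ball_inter hF y S)

/-- Enlarging the radius by a constant changes the number of integer points of a large ball by an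
arbitrarily small proportion, uniformly in the centre. -/
lemma exists_ballCount_intPoints_add_le (n : ℕ) {s δ : ℝ} (hs : 0 ≤ s) (hδ : 0 < δ) :
    ∃ R₀ ≥ 1, ∀ R, R₀ ≤ R → ∀ x : Fin n → ℝ,
      ballCount (intPoints n) x (R + s) ≤ (1 + δ) * ballCount (intPoints n) x R := by
  have h1 : Tendsto (fun R : ℝ => (1 + (2 * s + 2) / (2 * R - 1)) ^ n) atTop (nhds 1) := by
    have h2 : Tendsto (fun R : ℝ => 2 * R - 1) atTop atTop :=
      tendsto_atTop_add_const_right _ _ (tendsto_id.const_mul_atTop two_pos)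
    simpa using ((h2.const_div_atTop (2 * s + 2)).const_add 1).pow n
  obtain ⟨R₁, hR₁⟩ := eventually_atTop.1 (h1.eventually_le_const (by linarith : (1 : ℝ) < 1 + δ))
  refine ⟨max R₁ 1, le_max_right _ _, fun R hR x => ?_⟩
  have hR1 : 1 ≤ R := (le_max_right _ _).trans hR
  have h3 := hR₁ R ((le_max_left _ _).trans hR)
  have hpos : 0 < 2 * R - 1 := by linarith
  calc ballCount (intPoints n) x (R + s) ≤ (2 * (R + s) + 1) ^ n :=
        ballCount_intPoints_le_pow x (by linarith)
    _ = (1 + (2 * s + 2) / (2 * R - 1)) ^ n * (2 * R - 1) ^ n := by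
        rw [← mul_pow]
        congr 1
        field_simp
        ring
    _ ≤ (1 + δ) * ballCount (intPoints n) x R :=
        mul_le_mul h3 (pow_le_ballCount_intPoints x hR1) (by positivity) (by linarith)

lemma ballCount_translateSet {n : ℕ} (E : Set (Fin n → ℝ)) (x v : Fin n → ℝ) (R : ℝ) :
    ballCount (translateSet E v) (x + v) R = ballCount E x R := by
  have h : Metric.ball (x + v) R ∩ translateSet E v = (· + v) '' (Metric.ball x R ∩ E) := by
    ext y
    constructor
    · rintro ⟨h1, e, he, rfl⟩
      exact ⟨e, ⟨by simpa [Metric.mem_ball] using h1, he⟩, rfl⟩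
    · rintro ⟨e, ⟨h1, he⟩, rfl⟩
      exact ⟨by simpa [Metric.mem_ball] using h1, e, he, rfl⟩
  rw [ballCount, h, Set.ncard_image_of_injective _ (add_left_injective v), ballCount]

lemma add_mem_intPoints {n : ℕ} {x y : Fin n → ℝ} (hx : x ∈ intPoints n)
    (hy : y ∈ intPoints n) : x + y ∈ intPoints n := by
  obtain ⟨a, rfl⟩ := hx
  obtain ⟨b, rfl⟩ := hy
  exact ⟨a + b, by funext i; simp [intVec]⟩

lemma neg_mem_intPoints {n : ℕ} {x : Fin n → ℝ} (hx : x ∈ intPoints n) :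
    -x ∈ intPoints n := by
  obtain ⟨a, rfl⟩ := hx
  exact ⟨-a, by funext i; simp [intVec]⟩

lemma zero_mem_intPoints (n : ℕ) : (0 : Fin n → ℝ) ∈ intPoints n :=
  ⟨0, by funext i; simp [intVec]⟩

lemma translateSet_subset_intPoints {n : ℕ} {E : Set (Fin n → ℝ)} {v : Fin n → ℝ}
    (hE : E ⊆ intPoints n) (hv : v ∈ intPoints n) : translateSet E v ⊆ intPoints n := by
  rintro _ ⟨e, he, rfl⟩
  exact add_mem_intPoints (hE he) hv

lemma ballCount_intPoints_eq_zero_center {n : ℕ} {y : Fin n → ℝ} (hy : y ∈ intPoints n) (R : ℝ) :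
    ballCount (intPoints n) y R = ballCount (intPoints n) 0 R := by
  have h : translateSet (intPoints n) y = intPoints n :=
    (translateSet_subset_intPoints subset_rfl hy).antisymm fun z hz =>
      ⟨z + -y, add_mem_intPoints hz (neg_mem_intPoints hy), by simp⟩
  simpa [h] using ballCount_translateSet (intPoints n) 0 y R

lemma ballCount_add_ballCount_intPoints_le {n : ℕ} {E : Set (Fin n → ℝ)} (hE : E ⊆ intPoints n)
    (x : Fin n → ℝ) {R S : ℝ} (h : R ≤ S) :
    ballCount E x S + ballCount (intPoints n) x R ≤
      ballCount E x R + ballCount (intPoints n) x S := by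
  have hsub : Metric.ball x R ∩ intPoints n ⊆ Metric.ball x S ∩ intPoints n :=
    Set.inter_subset_inter_left _ (Metric.ball_subset_ball h)
  have h1 : Metric.ball x S ∩ E ⊆ (Metric.ball x R ∩ E) ∪
      ((Metric.ball x S ∩ intPoints n) \ (Metric.ball x R ∩ intPoints n)) := by
    rintro y ⟨hy, hyE⟩
    by_cases hyR : y ∈ Metric.ball x R
    · exact Or.inl ⟨hyR, hyE⟩
    · exact Or.inr ⟨⟨hy, hE hyE⟩, fun h => hyR h.1⟩
  have h2 := (Set.ncard_le_ncard h1 ((finite_ball_inter hE x R).union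
    ((finite_ball_inter_intPoints x S).sdiff))).trans (Set.ncard_union_le _ _)
  have h3 := Set.ncard_sdiff_add_ncard_of_subset hsub (finite_ball_inter_intPoints x S)
  unfold ballCount
  norm_cast
  omega

lemma ballCount_le_DRplus_mul {n : ℕ} {E : Set (Fin n → ℝ)} (hE : E ⊆ intPoints n)
    (x : Fin n → ℝ) {R : ℝ} (hR : 1 ≤ R) :
    ballCount E x R ≤ DRplus E R * ballCount (intPoints n) x R := by
  rw [← div_le_iff₀ (ballCount_intPoints_pos x hR)]
  refine le_ciSup (f := fun y => ballCount E y R / ballCount (intPoints n) y R) ⟨1, ?_⟩ x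
  rintro _ ⟨y, rfl⟩
  exact div_le_one_of_le₀ (ballCount_mono hE subset_rfl subset_rfl) (ballCount_nonneg _ _ _)

lemma ballCount_le_add_symmDiff {n : ℕ} {E F : Set (Fin n → ℝ)} (hE : E ⊆ intPoints n)
    (hF : F ⊆ intPoints n) (x : Fin n → ℝ) (R : ℝ) :
    ballCount E x R ≤ ballCount F x R + ballCount (symmDiff F E) x R := by
  have h1 : Metric.ball x R ∩ E ⊆
      (Metric.ball x R ∩ F) ∪ (Metric.ball x R ∩ symmDiff F E) := by
    rintro y ⟨hy, hyE⟩
    by_cases hyF : y ∈ F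
    · exact Or.inl ⟨hy, hyF⟩
    · exact Or.inr ⟨hy, Or.inr ⟨hyE, hyF⟩⟩
  have hFE : symmDiff F E ⊆ intPoints n :=
    symmDiff_le_sup.trans (Set.union_subset hF hE)
  unfold ballCount
  exact_mod_cast (Set.ncard_le_ncard h1 ((finite_ball_inter hF x R).union
    (finite_ball_inter hFE x R))).trans (Set.ncard_union_le _ _)

/-- The number of points of an almost periodic pattern in a large ball with integer centre
is almost independent of the centre. -/
lemma AlmostPeriodicPattern.exists_ballCount_le {n : ℕ} {Γ : Set (Fin n → ℝ)}
    (hΓ : AlmostPeriodicPattern Γ) {η : ℝ} (hη : 0 < η) :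
    ∃ R ≥ 1, ∀ x ∈ intPoints n, ∀ y ∈ intPoints n,
      ballCount Γ y R ≤ ballCount Γ x R + η * ballCount (intPoints n) 0 R := by
  obtain ⟨hZ, -, hap⟩ := hΓ
  obtain ⟨Rε, -, N, hN, ⟨M, hM, hMN⟩, hDR⟩ := hap (η / 2) (half_pos hη)
  obtain ⟨R₀, hR₀, hgrow⟩ := exists_ballCount_intPoints_add_le n hM.le (half_pos hη)
  refine ⟨max R₀ Rε, hR₀.trans (le_max_left _ _), fun x hx y hy => ?_⟩
  set R := max R₀ Rε
  have hR1 : 1 ≤ R := hR₀.trans (le_max_left _ _)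
  obtain ⟨v, hvb, hvN⟩ := hMN (y - x) M le_rfl
  have hv := hN hvN
  have hdist : dist y (x + v) < M := by
    rw [Metric.mem_ball, dist_comm, dist_eq_norm] at hvb
    rwa [dist_eq_norm, ← sub_sub]
  have h1 : ballCount Γ y R ≤ ballCount Γ (x + v) (R + M) :=
    ballCount_mono subset_rfl hZ (Metric.ball_subset_ball' (by linarith))
  have h2 := ballCount_add_ballCount_intPoints_le hZ (x + v) (by linarith : R ≤ R + M)
  have h3 := hgrow R (le_max_left _ _) (x + v)
  have hT := translateSet_subset_intPoints hZ hv
  have h4 := ballCount_le_add_symmDiff hZ hT (x + v) R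
  rw [ballCount_translateSet] at h4
  have h5 := ballCount_le_DRplus_mul
    (symmDiff_le_sup.trans (Set.union_subset hT hZ)) (x + v) hR1
  have h6 := mul_le_mul_of_nonneg_right (hDR R (le_max_right _ _) v hvN).le
    (ballCount_nonneg (intPoints n) (x + v) R)
  rw [ballCount_intPoints_eq_zero_center (add_mem_intPoints hx hv) R] at *
  linarith

lemma sum_ballCount_comm {n : ℕ} (A B : Finset (Fin n → ℝ)) (r : ℝ) :
    ∑ y ∈ A, ballCount (B : Set (Fin n → ℝ)) y r = ∑ b ∈ B, ballCount (A : Set _) b r := by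
  classical
  have h : ∀ (C : Finset (Fin n → ℝ)) (y : Fin n → ℝ),
      ballCount (C : Set _) y r = ((C.filter fun c => dist y c < r).card : ℝ) := by
    intro C y
    rw [ballCount, ← Set.ncard_coe_finset]
    congr 2
    ext c
    simp [dist_comm, and_comm]
  simp only [h]
  have := Finset.sum_card_bipartiteAbove_eq_sum_card_bipartiteBelow (s := A) (t := B)
    (fun y c => dist y c < r)
  simp only [Finset.bipartiteAbove, Finset.bipartiteBelow] at this
  simp only [dist_comm _ (_ : Fin n → ℝ)] at this ⊢
  exact_mod_cast this

lemma sum_ballCount_le {n : ℕ} {E : Set (Fin n → ℝ)} (hE : E ⊆ intPoints n)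
    (x : Fin n → ℝ) (R r : ℝ) :
    ∑ y ∈ (finite_ball_inter_intPoints x R).toFinset, ballCount E y r ≤
      ballCount E x (R + r) * ballCount (intPoints n) 0 r := by
  set A := (finite_ball_inter_intPoints x R).toFinset with hA
  set B := (finite_ball_inter hE x (R + r)).toFinset with hB
  have hBc : ballCount E x (R + r) = (B.card : ℝ) := by
    rw [ballCount, Set.ncard_eq_toFinset_card _ (finite_ball_inter hE x (R + r))]
  calc ∑ y ∈ A, ballCount E y r ≤ ∑ y ∈ A, ballCount (B : Set _) y r := by
        refine Finset.sum_le_sum fun y hy => ?_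
        have hy' : y ∈ Metric.ball x R := by
          rw [hA, Set.Finite.mem_toFinset] at hy
          exact hy.1
        unfold ballCount
        refine Nat.cast_le.2 (Set.ncard_le_ncard ?_ (B.finite_toSet.inter_of_right _))
        rintro z ⟨hz, hzE⟩
        refine ⟨hz, ?_⟩
        rw [hB, Set.Finite.coe_toFinset]
        refine ⟨?_, hzE⟩
        rw [Metric.mem_ball] at *
        linarith [dist_triangle z y x]
    _ = ∑ b ∈ B, ballCount (A : Set _) b r := sum_ballCount_comm A B r
    _ ≤ ∑ _b ∈ B, ballCount (intPoints n) 0 r := by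
        refine Finset.sum_le_sum fun b hb => ?_
        rw [hB, Set.Finite.mem_toFinset] at hb
        rw [← ballCount_intPoints_eq_zero_center (hE hb.2)]
        refine ballCount_mono ?_ subset_rfl subset_rfl
        rw [hA, Set.Finite.coe_toFinset]
        exact Set.inter_subset_right
    _ = _ := by rw [Finset.sum_const, nsmul_eq_mul, hBc]

lemma le_sum_ballCount {n : ℕ} {E : Set (Fin n → ℝ)} (hE : E ⊆ intPoints n)
    (x : Fin n → ℝ) (R r : ℝ) :
    ballCount E x R * ballCount (intPoints n) 0 r ≤
      ∑ y ∈ (finite_ball_inter_intPoints x (R + r)).toFinset, ballCount E y r := by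
  set A := (finite_ball_inter_intPoints x (R + r)).toFinset with hA
  set B := (finite_ball_inter hE x R).toFinset with hB
  have hBc : ballCount E x R = (B.card : ℝ) := by
    rw [ballCount, Set.ncard_eq_toFinset_card _ (finite_ball_inter hE x R)]
  calc _ = ∑ _b ∈ B, ballCount (intPoints n) 0 r := by
        rw [Finset.sum_const, nsmul_eq_mul, hBc]
    _ ≤ ∑ b ∈ B, ballCount (A : Set _) b r := by
        refine Finset.sum_le_sum fun b hb => ?_
        rw [hB, Set.Finite.mem_toFinset] at hb
        rw [← ballCount_intPoints_eq_zero_center (hE hb.2)]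
        have hb' := hb.1
        unfold ballCount
        refine Nat.cast_le.2 (Set.ncard_le_ncard ?_ (A.finite_toSet.inter_of_right _))
        rintro z ⟨hz, hzE⟩
        refine ⟨hz, ?_⟩
        rw [hA, Set.Finite.coe_toFinset]
        refine ⟨?_, hzE⟩
        rw [Metric.mem_ball] at *
        linarith [dist_triangle z b x]
    _ = ∑ y ∈ A, ballCount (B : Set _) y r := (sum_ballCount_comm A B r).symm
    _ ≤ ∑ y ∈ A, ballCount E y r := by
        refine Finset.sum_le_sum fun y _ => ballCount_mono ?_ hE subset_rfl
        rw [hB, Set.Finite.coe_toFinset]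
        exact Set.inter_subset_right

lemma AlmostPeriodicPattern.exists_abs_sub_le {n : ℕ} {Γ : Set (Fin n → ℝ)}
    (hΓ : AlmostPeriodicPattern Γ) {ε : ℝ} (hε : 0 < ε) :
    ∃ m : ℝ, ∃ R₀ ≥ 1, ∀ R, R₀ ≤ R → ∀ x : Fin n → ℝ,
      |ballCount Γ x R / ballCount (intPoints n) x R - m| ≤ ε := by
  obtain ⟨η, hη, hη1, hηε⟩ : ∃ η : ℝ, 0 < η ∧ η ≤ 1 ∧ 3 * η ≤ ε :=
    ⟨min 1 (ε / 3), by positivity, min_le_left _ _, by linarith [min_le_right 1 (ε / 3)]⟩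
  have hZ := hΓ.1
  obtain ⟨r, hr, hosc⟩ := hΓ.exists_ballCount_le hη
  obtain ⟨R₀, hR₀, hgrow⟩ := exists_ballCount_intPoints_add_le n (by linarith : 0 ≤ r) hη
  set K := ballCount (intPoints n) 0 r with hK
  have hKpos : 0 < K := ballCount_intPoints_pos 0 hr
  set m := ballCount Γ 0 r / K with hm
  have hmK : ballCount Γ 0 r = m * K := by rw [hm]; field_simp
  have hm0 : 0 ≤ m := div_nonneg (ballCount_nonneg _ _ _) hKpos.le
  have hm1 : m ≤ 1 := div_le_one_of_le₀ (ballCount_mono hZ subset_rfl subset_rfl) hKpos.le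
  have hcard : ∀ x R, ((finite_ball_inter_intPoints x R).toFinset.card : ℝ) =
      ballCount (intPoints n) x R := fun x R => by
    rw [ballCount, Set.ncard_eq_toFinset_card _ (finite_ball_inter_intPoints x R)]
  have hmem : ∀ {x : Fin n → ℝ} {R y}, y ∈ (finite_ball_inter_intPoints x R).toFinset →
      y ∈ intPoints n := fun hy => ((Set.Finite.mem_toFinset _).1 hy).2
  refine ⟨m, R₀ + r, by linarith, fun R hR x => ?_⟩
  have hpos := ballCount_intPoints_pos x (by linarith : 1 ≤ R)
  have hup : ballCount Γ x R ≤ (m + η) * ballCount (intPoints n) x (R + r) := by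
    refine le_of_mul_le_mul_right ((le_sum_ballCount hZ x R r).trans ?_) hKpos
    refine (Finset.sum_le_card_nsmul _ _ ((m + η) * K) fun y hy => ?_).trans_eq ?_
    · linarith [hosc 0 (zero_mem_intPoints n) y (hmem hy)]
    · rw [nsmul_eq_mul, hcard]; ring
  have hlow : (m - η) * ballCount (intPoints n) x (R - r) ≤ ballCount Γ x R := by
    have h := sum_ballCount_le hZ x (R - r) r
    rw [sub_add_cancel] at h
    refine le_of_mul_le_mul_right (le_trans ?_ h) hKpos
    refine le_trans (le_of_eq ?_) (Finset.card_nsmul_le_sum _ _ ((m - η) * K) fun y hy => ?_)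
    · rw [nsmul_eq_mul, hcard]; ring
    · linarith [hosc y (hmem hy) 0 (zero_mem_intPoints n)]
  have hg1 := hgrow R (by linarith) x
  have hg2 := hgrow (R - r) (by linarith) x
  rw [sub_add_cancel] at hg2
  have hmono : ballCount (intPoints n) x (R - r) ≤ ballCount (intPoints n) x R :=
    ballCount_mono subset_rfl subset_rfl (Metric.ball_subset_ball (by linarith))
  set P := ballCount (intPoints n) x R
  set Q := ballCount (intPoints n) x (R - r)
  have hQ : (1 - η) * P ≤ Q := by nlinarith
  rw [abs_sub_le_iff]
  constructor
  · rw [sub_le_iff_le_add, div_le_iff₀ hpos]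
    have h1 : (m + η) * ballCount (intPoints n) x (R + r) ≤ (m + η) * ((1 + η) * P) :=
      mul_le_mul_of_nonneg_left hg1 (by linarith)
    have h2 : (m + η) * (1 + η) ≤ ε + m := by nlinarith
    nlinarith
  · rw [sub_le_comm, le_div_iff₀ hpos]
    have h1 : m * ((1 - η) * P) ≤ m * Q := mul_le_mul_of_nonneg_left hQ hm0
    have h2 : η * Q ≤ η * P := mul_le_mul_of_nonneg_left hmono hη.le
    have h3 : m - ε ≤ m * (1 - η) - η := by nlinarith
    nlinarith

/-- Every almost periodic pattern possesses a uniform density, lying in `[0,1]`. -/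
theorem statement18 {n : ℕ} (Γ : Set (Fin n → ℝ)) (hΓ : AlmostPeriodicPattern Γ) :
    ∃ D : ℝ, 0 ≤ D ∧ D ≤ 1 ∧ HasUnifDensity Γ D := by
  have hZ := hΓ.1
  set d : (Fin n → ℝ) → ℝ → ℝ := fun x R => ballCount Γ x R / ballCount (intPoints n) x R
  have hcauchy : CauchySeq fun k : ℕ => d 0 k := by
    refine Metric.cauchySeq_iff'.2 fun ε hε => ?_
    obtain ⟨m, R₀, -, h⟩ := hΓ.exists_abs_sub_le (by linarith : 0 < ε / 3)
    refine ⟨⌈R₀⌉₊, fun k hk => ?_⟩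
    have h1 := abs_le.1 (h k (Nat.ceil_le.1 hk) 0)
    have h2 := abs_le.1 (h ⌈R₀⌉₊ (Nat.le_ceil _) 0)
    rw [Real.dist_eq, abs_lt]
    constructor <;> linarith [h1.1, h1.2, h2.1, h2.2]
  obtain ⟨D, hD⟩ := cauchySeq_tendsto_of_complete hcauchy
  refine ⟨D, ge_of_tendsto' hD fun k => div_nonneg (ballCount_nonneg _ _ _)
    (ballCount_nonneg _ _ _), le_of_tendsto' hD fun k => div_le_one_of_le₀
    (ballCount_mono hZ subset_rfl subset_rfl) (ballCount_nonneg _ _ _), fun ε hε => ?_⟩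
  obtain ⟨m, R₀, hR₀, h⟩ := hΓ.exists_abs_sub_le (half_pos hε)
  refine ⟨R₀, by linarith, fun R hR x => ?_⟩
  have hmD : |D - m| ≤ ε / 2 :=
    le_of_tendsto (hD.sub_const m).abs <| (eventually_ge_atTop ⌈R₀⌉₊).mono fun k hk =>
      h k (Nat.ceil_le.1 hk) 0
  calc _ ≤ |d x R - m| + |m - D| := abs_sub_le _ _ _
    _ ≤ ε / 2 + ε / 2 := add_le_add (h R hR x) (by rwa [abs_sub_comm])
    _ = ε := add_halves ε

end
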